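/- For every real number x ≥ 0, x is a (-τ)-integer if and only if x is a τ²-integer; that is, ℤ_{-τ} ∩ [0, +∞) = ℤ_{τ²} ∩ [0, +∞). -/

import Mathlib

/-- The Ito–Sadahiro transformation `T_{-β}` on `[l_β, r_β)`, where
`l_β = -β/(β+1)` and `r_β = 1/(β+1)`. -/
noncomputable def negT (β : ℝ) (x : ℝ) : ℝ :=
  -β * x - (⌊-β * x - (-β / (β + 1))⌋ : ℝ)

/-- `Fin(-β)`: reals `x` such that `(-β)^k * x ∈ (l_β, r_β)` for some `k : ℤ`
and some iterate of `T_{-β}` sends it to `0`. -/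
def negFin (β : ℝ) (x : ℝ) : Prop :=
  ∃ (k : ℤ) (n : ℕ), ((-β) ^ k * x ∈ Set.Ioo (-β / (β + 1)) (1 / (β + 1))) ∧
    (negT β)^[n] ((-β) ^ k * x) = 0

/-- The set `ℤ_{-β}` of `(-β)`-integers. -/
def negInt (β : ℝ) (x : ℝ) : Prop :=
  x = 0 ∨ ∃ (N : ℕ) (y : ℝ), y ∈ Set.Ioo (-β / (β + 1)) (1 / (β + 1)) ∧
    x = (-β) ^ (N + 1) * y ∧ (negT β)^[N + 1] y = 0

/-- The `(-β)`-digit `d_{i+1}(y)` of `y ∈ [l_β, r_β)` (indices shifted so that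
`negDigit β y i` is the digit `d_{i+1}(y)`). -/
noncomputable def negDigit (β : ℝ) (y : ℝ) (i : ℕ) : ℤ :=
  ⌊-β * ((negT β)^[i] y) - (-β / (β + 1))⌋

/-- The golden ratio `τ = (1+√5)/2`. -/
noncomputable def tau : ℝ := (1 + Real.sqrt 5) / 2

/-- The Rényi transformation `T_β` on `[0,1)`. -/
noncomputable def renyiT (β : ℝ) (x : ℝ) : ℝ := β * x - (⌊β * x⌋ : ℝ)

/-- The set `ℤ_β` of (nonnegative) `β`-integers. -/
def posInt (β : ℝ) (x : ℝ) : Prop :=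
  x = 0 ∨ ∃ N : ℕ, (β ^ (-(N + 1 : ℤ)) * x ∈ Set.Ico (0 : ℝ) 1) ∧
    (renyiT β)^[N + 1] (β ^ (-(N + 1 : ℤ)) * x) = 0

lemma tau_sq : tau ^ 2 = tau + 1 := by
  have h : Real.sqrt 5 ^ 2 = 5 := Real.sq_sqrt (by norm_num)
  unfold tau
  linear_combination h / 4

lemma tau_gt : 1.6 < tau := by
  have h : 2.2 < Real.sqrt 5 := Real.lt_sqrt_of_sq_lt (by norm_num)
  unfold tau
  linarith

lemma tau_lt : tau < 1.7 := by
  have h : Real.sqrt 5 < 2.4 := by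
    rw [Real.sqrt_lt' (by norm_num)]
    norm_num
  unfold tau
  linarith

lemma tau_left : -tau / (tau + 1) = 1 - tau := by
  have h1 := tau_gt
  rw [div_eq_iff (by linarith)]
  linear_combination tau_sq

lemma tau_right : 1 / (tau + 1) = 2 - tau := by
  have h1 := tau_gt
  rw [div_eq_iff (by linarith)]
  linear_combination tau_sq

lemma negT_tau_eq {u : ℝ} (d : ℤ) (h1 : 1 - tau ≤ -tau * u - d)
    (h2 : -tau * u - d < 2 - tau) : negT tau u = -tau * u - d := by
  have h : ⌊-tau * u - (-tau / (tau + 1))⌋ = d := by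
    rw [tau_left, Int.floor_eq_iff]
    constructor <;> linarith
  rw [negT, h]

lemma renyiT_eq {β v : ℝ} (d : ℤ) (h1 : 0 ≤ β * v - d) (h2 : β * v - d < 1) :
    renyiT β v = β * v - d := by
  have h : ⌊β * v⌋ = d := by
    rw [Int.floor_eq_iff]
    constructor <;> linarith
  rw [renyiT, h]

/-- The possible relative positions of `T_{-τ}^{2n}(y)` and `T_{τ²}^n(y)`. -/
def OrbitRel (u v : ℝ) : Prop :=
  (v = u ∧ 0 ≤ u ∧ u < 2 - tau) ∨ (v = u + 1 ∧ 1 - tau ≤ u ∧ u < 0) ∨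
    (v = u + (tau - 1) ∧ 1 - tau < u ∧ u < 0)

lemma OrbitRel.eq_zero_iff {u v : ℝ} (h : OrbitRel u v) : u = 0 ↔ v = 0 := by
  have := tau_lt
  rcases h with ⟨rfl, _, _⟩ | ⟨rfl, _, _⟩ | ⟨rfl, _, _⟩
  · rfl
  all_goals constructor <;> intro <;> linarith

lemma orbitRel_negT {s w : ℝ} (hs : -tau * s = w) (h0 : 0 ≤ w) (h1 : w < 1) :
    OrbitRel (negT tau s) w := by
  have := tau_gt
  have := tau_lt
  by_cases hw : w < 2 - tau
  · rw [negT_tau_eq 0 (by push_cast; linarith) (by push_cast; linarith)]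
    left
    push_cast
    refine ⟨?_, ?_, ?_⟩ <;> linarith
  · rw [negT_tau_eq 1 (by push_cast; linarith) (by push_cast; linarith)]
    right; left
    push_cast
    refine ⟨?_, ?_, ?_⟩ <;> linarith

lemma orbitRel_of_neg_digit_zero {u v : ℝ} (d : ℤ) (hu : u < 0) (hu' : -tau * u < 2 - tau)
    (hv : tau ^ 2 * v - d = tau ^ 2 * u + (tau - 1)) :
    OrbitRel (negT tau (negT tau u)) (renyiT (tau ^ 2) v) := by
  have g1 := tau_gt
  have g2 := tau_lt
  have hs := tau_sq
  have a : 0 < -tau * u := by nlinarith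
  have b : tau ^ 2 * u < 0 := by nlinarith
  have c : 1 - tau < tau ^ 2 * u := by nlinarith
  rw [negT_tau_eq (u := u) 0 (by push_cast; linarith) (by push_cast; linarith),
    renyiT_eq d (by linarith) (by linarith), hv]
  have e : -tau * (-tau * u - ((0 : ℤ) : ℝ)) = tau ^ 2 * u := by push_cast; ring
  rw [negT_tau_eq 0 (by rw [e]; push_cast; linarith) (by rw [e]; push_cast; linarith), e]
  right; right
  push_cast
  refine ⟨?_, ?_, ?_⟩ <;> linarith

lemma orbitRel_of_neg_digit_one {u v : ℝ} (d : ℤ) (hu : 1 - tau ≤ u) (hu' : 2 - tau ≤ -tau * u)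
    (hv : tau ^ 2 * v - d = tau ^ 2 * u + tau) :
    OrbitRel (negT tau (negT tau u)) (renyiT (tau ^ 2) v) := by
  have g1 := tau_gt
  have g2 := tau_lt
  have hs := tau_sq
  have a : -tau * u ≤ 1 := by nlinarith
  have b : 0 ≤ tau ^ 2 * u + tau := by nlinarith
  have c : tau ^ 2 * u + tau ≤ 1 := by nlinarith
  rw [negT_tau_eq (u := u) 1 (by push_cast; linarith) (by push_cast; linarith)]
  have e : -tau * (-tau * u - ((1 : ℤ) : ℝ)) = tau ^ 2 * u + tau := by push_cast; ring
  rcases c.lt_or_eq with c | c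
  · rw [renyiT_eq d (by linarith) (by linarith), hv]
    exact orbitRel_negT e b c
  · rw [renyiT_eq (d + 1) (by push_cast; linarith) (by push_cast; linarith),
      negT_tau_eq 1 (by rw [e]; push_cast; linarith) (by rw [e]; push_cast; linarith), e]
    left
    push_cast
    refine ⟨?_, ?_, ?_⟩ <;> linarith

lemma OrbitRel.step {u v : ℝ} (h : OrbitRel u v) :
    OrbitRel (negT tau (negT tau u)) (renyiT (tau ^ 2) v) := by
  have g1 := tau_gt
  have g2 := tau_lt
  have hs := tau_sq
  rcases h with ⟨rfl, h1, h2⟩ | ⟨rfl, h1, h2⟩ | ⟨rfl, h1, h2⟩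
  · have a : 0 ≤ tau ^ 2 * v := by positivity
    have b : tau ^ 2 * v < 1 := by nlinarith
    have c : 0 ≤ tau * v := by nlinarith
    have c' : tau * v < tau - 1 := by nlinarith
    rw [negT_tau_eq (u := v) 0 (by push_cast; linarith) (by push_cast; linarith),
      renyiT_eq 0 (by push_cast; linarith) (by push_cast; linarith)]
    have := orbitRel_negT (s := -tau * v) (w := tau ^ 2 * v) (by ring) a b
    simpa using this
  · rcases lt_or_ge (-tau * u) (2 - tau) with h | h
    · exact orbitRel_of_neg_digit_zero 2 h2 h (by push_cast; linear_combination hs)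
    · exact orbitRel_of_neg_digit_one 1 h1 h (by push_cast; linear_combination hs)
  · rcases lt_or_ge (-tau * u) (2 - tau) with h | h
    · exact orbitRel_of_neg_digit_zero 1 h2 h (by push_cast; linear_combination tau * hs)
    · exact orbitRel_of_neg_digit_one 0 h1.le h (by push_cast; linear_combination tau * hs)

lemma orbitRel_iterate {y : ℝ} (h0 : 0 ≤ y) (h1 : y < 2 - tau) (n : ℕ) :
    OrbitRel ((negT tau)^[2 * n] y) ((renyiT (tau ^ 2))^[n] y) := by
  induction n with
  | zero => exact Or.inl ⟨rfl, h0, h1⟩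
  | succ n ih =>
    rw [show 2 * (n + 1) = (2 * n + 1) + 1 by ring]
    simp only [Function.iterate_succ_apply']
    exact ih.step

lemma negT_iterate_two_mul_eq_zero_iff {y : ℝ} (h0 : 0 ≤ y) (h1 : y < 2 - tau) (n : ℕ) :
    (negT tau)^[2 * n] y = 0 ↔ (renyiT (tau ^ 2))^[n] y = 0 :=
  (orbitRel_iterate h0 h1 n).eq_zero_iff

lemma posInt_tau_sq_of_negT {y : ℝ} (h0 : 0 ≤ y) (h1 : y < 2 - tau) (n : ℕ)
    (h : (negT tau)^[2 * (n + 1)] y = 0) : posInt (tau ^ 2) (tau ^ (2 * (n + 1)) * y) := by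
  have g1 := tau_gt
  have e : (tau ^ 2) ^ (-(n + 1 : ℤ)) * (tau ^ (2 * (n + 1)) * y) = y := by
    rw [pow_mul, ← mul_assoc, ← zpow_natCast (tau ^ 2), ← zpow_add₀ (by positivity)]
    simp
  refine Or.inr ⟨n, ?_, ?_⟩
  · rw [e]
    exact ⟨h0, by linarith⟩
  · rw [e]
    exact (negT_iterate_two_mul_eq_zero_iff h0 h1 _).1 h

/-- `ℤ_{-τ} ∩ [0, ∞) = ℤ_{τ²} ∩ [0, ∞)`. -/
theorem negTau_int_eq_tauSq_int_on_nonneg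
    (x : ℝ) (hx : 0 ≤ x) :
    negInt tau x ↔ posInt (tau ^ 2) x := by
  have g1 := tau_gt
  have g2 := tau_lt
  have hs := tau_sq
  have hpos : 0 < tau := by linarith
  unfold negInt
  rw [tau_left, tau_right]
  constructor
  · rintro (h | ⟨N, y, ⟨hl, hr⟩, hxy, hT⟩)
    · exact Or.inl h
    rcases Nat.even_or_odd' (N + 1) with ⟨m, hm | hm⟩
    · obtain ⟨n, rfl⟩ : ∃ n, m = n + 1 := ⟨m - 1, by omega⟩
      rw [hm, Even.neg_pow (even_two_mul _)] at hxy
      rw [hm] at hT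
      subst hxy
      exact posInt_tau_sq_of_negT (nonneg_of_mul_nonneg_right hx (by positivity)) hr n hT
    · rw [hm, Odd.neg_pow (odd_two_mul_add_one m)] at hxy
      rw [hm] at hT
      have hp : 0 < tau ^ (2 * m + 1) := by positivity
      have hy : y ≤ 0 := by
        by_contra! hy
        nlinarith [mul_pos hp hy]
      have hy' : -tau * (-y / tau) = y := by field_simp
      have hz : negT tau (-y / tau) = y := by
        rw [negT_tau_eq 0 (by rw [hy']; push_cast; linarith) (by rw [hy']; push_cast; linarith),
          hy']
        simp
      have hx' : x = tau ^ (2 * (m + 1)) * (-y / tau) := by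
        rw [hxy]
        field_simp
        ring
      rw [hx']
      refine posInt_tau_sq_of_negT (div_nonneg (by linarith) hpos.le) ?_ m ?_
      · rw [div_lt_iff₀ hpos]
        nlinarith
      · rw [show 2 * (m + 1) = (2 * m + 1) + 1 by ring, Function.iterate_succ_apply, hz, hT]
  · rintro (h | ⟨N, ⟨h0, h1⟩, hR⟩)
    · exact Or.inl h
    set z := (tau ^ 2) ^ (-(N + 1 : ℤ)) * x with hz
    have hxz : x = (tau ^ 2) ^ (N + 1) * z := by
      rw [hz, ← mul_assoc, ← zpow_natCast, ← zpow_add₀ (by positivity)]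
      simp
    have e : tau ^ 2 * (z / tau ^ 2) = z := by field_simp
    have hRy : renyiT (tau ^ 2) (z / tau ^ 2) = z := by
      rw [renyiT_eq 0 (by rw [e]; push_cast; linarith) (by rw [e]; push_cast; linarith), e]
      simp
    have hy0 : 0 ≤ z / tau ^ 2 := by positivity
    have hy1 : z / tau ^ 2 < 2 - tau := by
      rw [div_lt_iff₀ (by positivity)]
      nlinarith
    refine Or.inr ⟨2 * N + 3, z / tau ^ 2, ⟨by linarith, hy1⟩, ?_, ?_⟩
    · rw [show 2 * N + 3 + 1 = 2 * (N + 2) by ring, Even.neg_pow (even_two_mul _), hxz, pow_mul]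
      field_simp
      ring
    · rw [show 2 * N + 3 + 1 = 2 * (N + 2) by ring, negT_iterate_two_mul_eq_zero_iff hy0 hy1,
        Function.iterate_succ_apply, hRy, hR]
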